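/- Let Q_H be a symmetric positive semidefinite N×N real matrix, G a real M×N matrix, D > 0, and let P be the orthogonal projection matrix onto ker(G). Then the supremum of tr(Q_H Σ) over all symmetric positive semidefinite N×N matrices Σ with tr(Σ) ≤ D and G Σ Gᵀ = 0 equals D·λ_max(P Q_H P), where λ_max denotes the largest eigenvalue of the symmetric matrix P Q_H P, and this supremum is attained. -/

import Mathlib

open Matrix

section factor
open scoped MatrixOrder

theorem posSemidef_exists_factor {N : ℕ} (S : Matrix (Fin N) (Fin N) ℝ) (hS : S.PosSemidef) :
    ∃ B : Matrix (Fin N) (Fin N) ℝ, S = Bᴴ * B :=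
  CStarAlgebra.nonneg_iff_eq_star_mul_self.mp hS.nonneg

end factor

/-- **Optimal perfectly stealthy damage.**
Let `Q_H` be symmetric positive semidefinite, `G` a real `M × N` matrix, `D > 0`, and `P`
the orthogonal projection onto `ker G` (symmetric, idempotent, with range `ker G`).
Then the supremum of `tr(Q_H Σ)` over all symmetric PSD `Σ` with `tr Σ ≤ D` and
`G Σ Gᵀ = 0` equals `D · λ_max(P Q_H P)` and is attained; this is expressed by saying
that `D · λ_max(P Q_H P)` is the greatest element of the set of attainable values
`tr(Q_H Σ)`. (Here `λ_max` is realized as the supremum of the eigenvalues of the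
symmetric matrix `P * Q_H * P`, which equals `0` for the zero matrix.) -/
theorem stealthy_damage_isGreatest_D_mul_lambdaMax
    {M N : ℕ}
    (QH : Matrix (Fin N) (Fin N) ℝ) (hQH : QH.PosSemidef)
    (G : Matrix (Fin M) (Fin N) ℝ)
    (D : ℝ) (hD : 0 < D)
    (P : Matrix (Fin N) (Fin N) ℝ)
    (hPsymm : P.IsHermitian) (hPidem : P * P = P)
    (hPrange : LinearMap.range P.mulVecLin = LinearMap.ker G.mulVecLin)
    (hPQHP : (P * QH * P).IsHermitian) :
    IsGreatest
      {t : ℝ | ∃ Sig : Matrix (Fin N) (Fin N) ℝ,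
        Sig.PosSemidef ∧ Sig.trace ≤ D ∧ G * Sig * Gᵀ = 0 ∧ t = (QH * Sig).trace}
      (D * ⨆ i, hPQHP.eigenvalues i) := by
  have hGP : G * P = 0 := by
    apply Matrix.ext_of_mulVec_single
    intro j
    rw [← Matrix.mulVec_mulVec, Matrix.zero_mulVec]
    have : P *ᵥ Pi.single j 1 ∈ LinearMap.ker G.mulVecLin := by
      rw [← hPrange]
      exact ⟨Pi.single j 1, by simp⟩
    simpa using this
  have hA : (P * QH * P).PosSemidef := by
    have h := hQH.mul_mul_conjTranspose_same P
    rwa [hPsymm.eq] at h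
  have hnn : ∀ i, 0 ≤ hPQHP.eigenvalues i := fun i => hA.eigenvalues_nonneg i
  have hbdd : BddAbove (Set.range hPQHP.eigenvalues) := (Set.finite_range _).bddAbove
  have hlam : 0 ≤ ⨆ i, hPQHP.eigenvalues i := Real.iSup_nonneg hnn
  constructor
  · rcases hlam.eq_or_lt with h0 | hpos
    · refine ⟨0, Matrix.PosSemidef.zero, ?_, ?_, ?_⟩
      · simpa using hD.le
      · simp
      · rw [← h0]; simp
    · have hne : Nonempty (Fin N) := by
        by_contra hcon
        rw [not_nonempty_iff] at hcon
        rw [Real.iSup_of_isEmpty] at hpos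
        exact lt_irrefl _ hpos
      obtain ⟨i, hi⟩ := exists_eq_ciSup_of_finite (f := hPQHP.eigenvalues)
      rw [← hi] at hpos ⊢
      set l := hPQHP.eigenvalues i with hl
      set v : Fin N → ℝ := ⇑(hPQHP.eigenvectorBasis i) with hv
      have hAv : (P * QH * P) *ᵥ v = l • v := hPQHP.mulVec_eigenvectorBasis i
      have hvv : v ⬝ᵥ v = 1 := by
        have h1 := hPQHP.eigenvectorBasis.orthonormal.1 i
        have h2 := real_inner_self_eq_norm_sq (hPQHP.eigenvectorBasis i)
        rw [h1, EuclideanSpace.inner_eq_star_dotProduct] at h2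
        simpa using h2
      have hPv : P *ᵥ v = v := by
        have h : P *ᵥ (l • v) = l • v := by
          rw [← hAv, Matrix.mulVec_mulVec]
          congr 1
          simp only [← Matrix.mul_assoc, hPidem]
        rw [Matrix.mulVec_smul] at h
        exact smul_right_injective _ hpos.ne' h
      have hGv : G *ᵥ v = 0 := by
        rw [← hPv, Matrix.mulVec_mulVec, hGP, Matrix.zero_mulVec]
      have hPt : Pᵀ = P := by
        have := hPsymm.eq
        rwa [Matrix.conjTranspose_eq_transpose_of_trivial] at this
      have hQ : (QH *ᵥ v) ⬝ᵥ v = l := by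
        have h1 : (P *ᵥ (QH *ᵥ v)) = l • v := by
          rw [← hAv, ← Matrix.mulVec_mulVec, hPv, ← Matrix.mulVec_mulVec]
        have h2 : (P *ᵥ (QH *ᵥ v)) ⬝ᵥ v = l := by
          rw [h1, smul_dotProduct, hvv]; simp
        rw [← h2, dotProduct_comm (P *ᵥ _), Matrix.dotProduct_mulVec,
          ← Matrix.mulVec_transpose, hPt, hPv, dotProduct_comm]
      refine ⟨D • Matrix.vecMulVec v v, ?_, ?_, ?_, ?_⟩
      · have h := Matrix.posSemidef_vecMulVec_self_star v
        rw [star_trivial] at h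
        exact h.smul hD.le
      · rw [Matrix.trace_smul, Matrix.trace_vecMulVec, hvv]; simp
      · rw [Matrix.mul_smul, Matrix.mul_vecMulVec, hGv]; simp
      · rw [Matrix.mul_smul, Matrix.mul_vecMulVec, Matrix.trace_smul, Matrix.trace_vecMulVec, hQ]
        simp
  · rintro t ⟨S, hS, htr, hG, rfl⟩
    have hGS : G * S = 0 := by
      obtain ⟨B, rfl⟩ := posSemidef_exists_factor S hS
      have h : (G * Bᴴ) * (G * Bᴴ)ᴴ = 0 := by
        rw [Matrix.conjTranspose_mul, Matrix.conjTranspose_conjTranspose,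
          Matrix.conjTranspose_eq_transpose_of_trivial G, ← hG]
        simp only [Matrix.mul_assoc]
      rw [Matrix.self_mul_conjTranspose_eq_zero] at h
      rw [← Matrix.mul_assoc, h, Matrix.zero_mul]
    have hPS : P * S = S := by
      apply Matrix.ext_of_mulVec_single
      intro j
      have hm : S *ᵥ Pi.single j 1 ∈ LinearMap.range P.mulVecLin := by
        rw [hPrange, LinearMap.mem_ker, Matrix.mulVecLin_apply, Matrix.mulVec_mulVec, hGS,
          Matrix.zero_mulVec]
      obtain ⟨w, hw⟩ := hm
      rw [Matrix.mulVecLin_apply] at hw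
      rw [← Matrix.mulVec_mulVec, ← hw, Matrix.mulVec_mulVec, hPidem]
    have hSP : S * P = S := by
      have h := congrArg Matrix.conjTranspose hPS
      rwa [Matrix.conjTranspose_mul, hPsymm.eq, hS.1.eq] at h
    have htrA : (QH * S).trace = (P * QH * P * S).trace := by
      rw [Matrix.mul_assoc (P * QH), hPS, Matrix.mul_assoc, Matrix.trace_mul_comm P, Matrix.mul_assoc, hSP]
    set U : Matrix (Fin N) (Fin N) ℝ := hPQHP.eigenvectorUnitary.1 with hU
    have hUU : U * Uᴴ = 1 := Unitary.mul_star_self_of_mem hPQHP.eigenvectorUnitary.2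
    have hspec : P * QH * P = U * Matrix.diagonal hPQHP.eigenvalues * Uᴴ := by
      have := hPQHP.spectral_theorem
      rw [Unitary.conjStarAlgAut_apply] at this
      exact this
    have hT : (Uᴴ * S * U).PosSemidef := hS.conjTranspose_mul_mul_same U
    have hTtr : (Uᴴ * S * U).trace = S.trace := by
      rw [Matrix.trace_mul_comm, ← Matrix.mul_assoc, hUU, Matrix.one_mul]
    have hfin : (QH * S).trace = ∑ i, hPQHP.eigenvalues i * (Uᴴ * S * U) i i := by
      have h1 : (P * QH * P * S).trace
          = (Matrix.diagonal hPQHP.eigenvalues * (Uᴴ * S * U)).trace := by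
        conv_lhs => rw [hspec]
        rw [Matrix.mul_assoc, Matrix.mul_assoc, Matrix.trace_mul_comm]
        simp only [Matrix.mul_assoc]
      rw [htrA, h1]
      simp [Matrix.trace, Matrix.diagonal_mul]
    rw [hfin]
    calc ∑ i, hPQHP.eigenvalues i * (Uᴴ * S * U) i i
        ≤ ∑ i, (⨆ i, hPQHP.eigenvalues i) * (Uᴴ * S * U) i i :=
          Finset.sum_le_sum fun i _ =>
            mul_le_mul_of_nonneg_right (le_ciSup hbdd i) hT.diag_nonneg
      _ = (⨆ i, hPQHP.eigenvalues i) * S.trace := by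
          rw [← Finset.mul_sum, ← hTtr]; rfl
      _ ≤ (⨆ i, hPQHP.eigenvalues i) * D := mul_le_mul_of_nonneg_left htr hlam
      _ = _ := mul_comm _ _
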